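/- arXiv:2502.21192 — 2 statements merged into one kernel-verified Lean document; each statement's English description precedes it below -/
import Mathlib

section
/- Let (B, ‖·‖) be a normed vector space, let f : [0,1] → B be continuous, let p ≥ 1 be real and let γ' > 1/p. Then sup_{0 ≤ s < t ≤ 1} ‖f(t) − f(s)‖^p / (t − s)^{γ'p − 1} ≤ (8 · 4^{1/p} · (γ' + 1/p)/(γ' − 1/p))^p · ∫₀¹∫₀¹ ‖f(x) − f(y)‖^p / |x − y|^{γ'p + 1} dx dy. -/
open MeasureTheory Set

/-- Jensen's inequality for `x ↦ |x| ^ p` and a probability measure, with an extended integral. -/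
theorem ofReal_abs_integral_rpow_le {α : Type*} [MeasurableSpace α] {μ : Measure α}
    [IsProbabilityMeasure μ] {F : α → ℝ} (hF : Integrable F μ) {p : ℝ} (hp : 1 ≤ p) :
    ENNReal.ofReal (|∫ x, F x ∂μ| ^ p) ≤ ∫⁻ x, ENNReal.ofReal (|F x| ^ p) ∂μ := by
  have hp0 : 0 < p := by linarith
  have h1 : ‖∫ x, F x ∂μ‖ₑ ≤ eLpNorm F (ENNReal.ofReal p) μ :=
    calc ‖∫ x, F x ∂μ‖ₑ ≤ ∫⁻ x, ‖F x‖ₑ ∂μ := enorm_integral_le_lintegral_enorm _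
      _ = eLpNorm F 1 μ := eLpNorm_one_eq_lintegral_enorm.symm
      _ ≤ _ := eLpNorm_le_eLpNorm_of_exponent_le (by simpa using hp) hF.1
  rw [eLpNorm_eq_lintegral_rpow_enorm_toReal (by simpa using hp0) (by simp),
    ENNReal.toReal_ofReal hp0.le, one_div, ENNReal.le_rpow_inv_iff hp0] at h1
  simpa only [Real.enorm_eq_ofReal_abs, ENNReal.ofReal_rpow_of_nonneg (abs_nonneg _) hp0.le]
    using h1

/-- The `p`-th power of a difference of means is at most the mean of the `p`-th powers of the
differences. -/
theorem ofReal_abs_integral_sub_integral_rpow_le {α : Type*} [MeasurableSpace α]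
    {μ ν : Measure α} [IsProbabilityMeasure μ] [IsProbabilityMeasure ν] {g : α → ℝ}
    (hμ : Integrable g μ) (hν : Integrable g ν) {p : ℝ} (hp : 1 ≤ p) :
    ENNReal.ofReal (|∫ x, g x ∂μ - ∫ x, g x ∂ν| ^ p) ≤
      ∫⁻ q, ENNReal.ofReal (|g q.1 - g q.2| ^ p) ∂(μ.prod ν) := by
  have h := ofReal_abs_integral_rpow_le ((hμ.comp_fst ν).sub (hν.comp_snd μ)) hp
  simp only [Pi.sub_apply] at h
  rwa [integral_sub (hμ.comp_fst ν) (hν.comp_snd μ), integral_fun_fst, integral_fun_snd,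
    probReal_univ, probReal_univ, one_smul, one_smul] at h

theorem isProbabilityMeasure_cond_Icc {a b : ℝ} (hab : a < b) :
    IsProbabilityMeasure (ProbabilityTheory.cond volume (Icc a b)) :=
  ProbabilityTheory.cond_isProbabilityMeasure_of_finite (by simpa using hab) (by simp)

theorem integrable_cond_Icc {g : ℝ → ℝ} (hg : Continuous g) {a b : ℝ} (hab : a < b) :
    Integrable g (ProbabilityTheory.cond volume (Icc a b)) :=
  (hg.integrableOn_Icc).smul_measure (by simpa using hab)

/-- Two means of `g` over nested intervals differ by at most the fractional Sobolev energy of any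
`f` whose increments dominate those of `g`. -/
theorem abs_integral_cond_Icc_sub_rpow_le {B : Type*} [NormedAddCommGroup B] {f : ℝ → B}
    {g : ℝ → ℝ} (hg : Continuous g)
    (hfg : ∀ x ∈ Icc (0 : ℝ) 1, ∀ y ∈ Icc (0 : ℝ) 1, |g x - g y| ≤ ‖f x - f y‖)
    {p κ G a b c d : ℝ} (hp : 1 ≤ p) (hκ : 0 ≤ κ) (hG : 0 ≤ G)
    (h_energy : ∫⁻ q in Icc (0 : ℝ) 1 ×ˢ Icc (0 : ℝ) 1,
      ENNReal.ofReal (‖f q.1 - f q.2‖ ^ p / |q.1 - q.2| ^ κ) ≤ ENNReal.ofReal G)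
    (ha : 0 ≤ a) (hac : a ≤ c) (hcd : c < d) (hdb : d ≤ b) (hb : b ≤ 1) :
    |∫ x, g x ∂(ProbabilityTheory.cond volume (Icc a b)) -
      ∫ x, g x ∂(ProbabilityTheory.cond volume (Icc c d))| ^ p ≤
      (b - a) ^ κ / ((b - a) * (d - c)) * G := by
  have hab : a < b := by linarith
  have hp0 : 0 < p := by linarith
  have := isProbabilityMeasure_cond_Icc hab
  have := isProbabilityMeasure_cond_Icc hcd
  have hba : 0 < b - a := by linarith
  have hdc : 0 < d - c := by linarith
  have h := ofReal_abs_integral_sub_integral_rpow_le (integrable_cond_Icc hg hab)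
    (integrable_cond_Icc hg hcd) hp
  have hsub : Icc a b ×ˢ Icc c d ⊆ Icc (0 : ℝ) 1 ×ˢ Icc (0 : ℝ) 1 :=
    prod_mono (Icc_subset_Icc ha hb) (Icc_subset_Icc (by linarith) (by linarith))
  have h_int : ∫⁻ q in Icc a b ×ˢ Icc c d, ENNReal.ofReal (|g q.1 - g q.2| ^ p) ≤
      ENNReal.ofReal ((b - a) ^ κ * G) := by
    calc ∫⁻ q in Icc a b ×ˢ Icc c d, ENNReal.ofReal (|g q.1 - g q.2| ^ p)
      _ ≤ ∫⁻ q in Icc a b ×ˢ Icc c d, ENNReal.ofReal ((b - a) ^ κ) *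
          ENNReal.ofReal (‖f q.1 - f q.2‖ ^ p / |q.1 - q.2| ^ κ) := by
        refine setLIntegral_mono' (measurableSet_Icc.prod measurableSet_Icc) ?_
        rintro ⟨x, y⟩ hq
        have hq' := hsub hq
        obtain ⟨⟨hx1, hx2⟩, hy1, hy2⟩ := hq
        dsimp only at hx1 hx2 hy1 hy2 ⊢
        rw [← ENNReal.ofReal_mul (by positivity)]
        refine ENNReal.ofReal_le_ofReal ?_
        rcases eq_or_ne x y with rfl | hxy
        · rw [sub_self, abs_zero, Real.zero_rpow hp0.ne']
          positivity
        have hpos : 0 < |x - y| := abs_pos.2 (sub_ne_zero.2 hxy)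
        rw [mul_div_assoc', le_div_iff₀ (by positivity), mul_comm]
        gcongr
        · exact abs_le.2 ⟨by linarith, by linarith⟩
        · exact hfg x hq'.1 y hq'.2
      _ = ENNReal.ofReal ((b - a) ^ κ) * ∫⁻ q in Icc a b ×ˢ Icc c d,
          ENNReal.ofReal (‖f q.1 - f q.2‖ ^ p / |q.1 - q.2| ^ κ) :=
        lintegral_const_mul' _ _ ENNReal.ofReal_ne_top
      _ ≤ ENNReal.ofReal ((b - a) ^ κ) * ENNReal.ofReal G := by
        gcongr
        exact (lintegral_mono_set hsub).trans h_energy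
      _ = _ := (ENNReal.ofReal_mul (by positivity)).symm
  have hprod : (ProbabilityTheory.cond volume (Icc a b)).prod
      (ProbabilityTheory.cond volume (Icc c d)) = ENNReal.ofReal (b - a)⁻¹ •
        ENNReal.ofReal (d - c)⁻¹ • (volume : Measure (ℝ × ℝ)).restrict (Icc a b ×ˢ Icc c d) := by
    rw [ProbabilityTheory.cond, ProbabilityTheory.cond, Measure.prod_smul_left,
      Measure.prod_smul_right, Measure.prod_restrict, ← Measure.volume_eq_prod,
      Real.volume_Icc, Real.volume_Icc, ← ENNReal.ofReal_inv_of_pos hba,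
      ← ENNReal.ofReal_inv_of_pos hdc]
  rw [hprod, lintegral_smul_measure, lintegral_smul_measure, smul_eq_mul, smul_eq_mul] at h
  rw [← ENNReal.ofReal_le_ofReal_iff (by positivity)]
  refine h.trans ?_
  have hfactor : (b - a) ^ κ / ((b - a) * (d - c)) * G =
      (b - a)⁻¹ * ((d - c)⁻¹ * ((b - a) ^ κ * G)) := by
    field_simp
  rw [hfactor, ENNReal.ofReal_mul (by positivity), ENNReal.ofReal_mul (by positivity)]
  gcongr

/-- The means of a continuous function over intervals shrinking to `c` converge to its value. -/
theorem tendsto_integral_cond_Icc {g : ℝ → ℝ} (hg : Continuous g) {a b : ℕ → ℝ} {c : ℝ}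
    (hab : ∀ n, a n < b n) (ha : Filter.Tendsto a Filter.atTop (nhds c))
    (hb : Filter.Tendsto b Filter.atTop (nhds c)) :
    Filter.Tendsto (fun n ↦ ∫ x, g x ∂(ProbabilityTheory.cond volume (Icc (a n) (b n))))
      Filter.atTop (nhds (g c)) := by
  rw [Metric.tendsto_nhds]
  intro ε hε
  obtain ⟨δ, hδ, hgδ⟩ := Metric.continuous_iff.1 hg c (ε / 2) (by positivity)
  filter_upwards [Metric.tendsto_nhds.1 ha δ hδ, Metric.tendsto_nhds.1 hb δ hδ] with n hna hnb
  have := isProbabilityMeasure_cond_Icc (hab n)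
  have h := norm_integral_le_of_norm_le_const (C := ε / 2) (f := fun x ↦ g x - g c)
    (μ := ProbabilityTheory.cond volume (Icc (a n) (b n))) (by
      filter_upwards [ProbabilityTheory.ae_cond_mem measurableSet_Icc] with x hx
      refine (hgδ x ?_).le
      rw [Real.dist_eq, abs_lt] at hna hnb ⊢
      exact ⟨by linarith [hx.1], by linarith [hx.2]⟩)
  rw [integral_sub (integrable_cond_Icc hg (hab n)) (integrable_const _), integral_const,
    probReal_univ, one_smul, mul_one] at h
  rw [dist_eq_norm]
  linarith

/-- Distance between the mean of `g` over `[s, t]` and its value at a point of `[s, t]`. -/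
theorem abs_integral_cond_Icc_sub_le {B : Type*} [NormedAddCommGroup B] {f : ℝ → B}
    {g : ℝ → ℝ} (hg : Continuous g)
    (hfg : ∀ x ∈ Icc (0 : ℝ) 1, ∀ y ∈ Icc (0 : ℝ) 1, |g x - g y| ≤ ‖f x - f y‖)
    {p β G s t c r : ℝ} (hp : 1 ≤ p) (hβ : 0 < β) (hG : 0 ≤ G)
    (h_energy : ∫⁻ q in Icc (0 : ℝ) 1 ×ˢ Icc (0 : ℝ) 1,
      ENNReal.ofReal (‖f q.1 - f q.2‖ ^ p / |q.1 - q.2| ^ (β + 2)) ≤ ENNReal.ofReal G)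
    (hs : 0 ≤ s) (hst : s < t) (ht : t ≤ 1) (hc : c ∈ Icc s t) (hr0 : 0 < r) (hr1 : r < 1) :
    |∫ x, g x ∂(ProbabilityTheory.cond volume (Icc s t)) - g c| ≤
      ((t - s) ^ β * r⁻¹ * G) ^ p⁻¹ / (1 - r ^ (β / p)) := by
  have hp0 : 0 < p := by linarith
  obtain ⟨hsc, hct⟩ := hc
  have hd : 0 < t - s := by linarith
  set a : ℕ → ℝ := fun n ↦ c - (c - s) * r ^ n with ha
  set b : ℕ → ℝ := fun n ↦ c + (t - c) * r ^ n with hb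
  have hba : ∀ n, b n - a n = (t - s) * r ^ n := fun n ↦ by simp only [ha, hb]; ring
  have hab : ∀ n, a n < b n := fun n ↦ by
    have := hba n
    have : 0 < (t - s) * r ^ n := by positivity
    linarith
  have hrn := tendsto_pow_atTop_nhds_zero_of_lt_one hr0.le hr1
  have hta : Filter.Tendsto a Filter.atTop (nhds c) := by
    simpa using (hrn.const_mul (c - s)).const_sub c
  have htb : Filter.Tendsto b Filter.atTop (nhds c) := by
    simpa using (hrn.const_mul (t - c)).const_add c
  have hpow : ∀ n : ℕ, r ^ n ≤ 1 := fun n ↦ pow_le_one₀ hr0.le hr1.le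
  have hsucc : ∀ n : ℕ, r ^ (n + 1) ≤ r ^ n := fun n ↦
    pow_le_pow_of_le_one hr0.le hr1.le n.le_succ
  have h := dist_le_of_le_geometric_of_tendsto₀ (r ^ (β / p)) (((t - s) ^ β * r⁻¹ * G) ^ p⁻¹)
    (Real.rpow_lt_one hr0.le hr1 (by positivity)) ?_ (tendsto_integral_cond_Icc hg hab hta htb)
  · simpa [ha, hb, Real.dist_eq] using h
  intro n
  rw [Real.dist_eq]
  have hn := abs_integral_cond_Icc_sub_rpow_le hg hfg hp (by positivity) hG h_energy
    (a := a n) (b := b n) (c := a (n + 1)) (d := b (n + 1))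
    (by simp only [ha]; nlinarith [hpow n]) (by simp only [ha]; nlinarith [hsucc n])
    (hab _) (by simp only [hb]; nlinarith [hsucc n]) (by simp only [hb]; nlinarith [hpow n])
  rw [← Real.le_rpow_inv_iff_of_pos (abs_nonneg _)
    (by have := hab n; have := hab (n + 1); have : 0 < b n - a n := by linarith
        have : 0 < b (n + 1) - a (n + 1) := by linarith
        positivity) hp0, hba, hba] at hn
  refine hn.trans_eq ?_
  have hexp : ((t - s) * r ^ n) ^ (β + 2) / ((t - s) * r ^ n * ((t - s) * r ^ (n + 1))) * G =
      (t - s) ^ β * r⁻¹ * G * (r ^ n) ^ β := by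
    rw [Real.rpow_add (by positivity), Real.rpow_two, Real.mul_rpow hd.le (by positivity)]
    field_simp
    ring
  rw [hexp, Real.mul_rpow (by positivity) (by positivity), ← Real.rpow_mul (by positivity),
    ← Real.rpow_natCast, ← Real.rpow_mul hr0.le, mul_comm (n : ℝ), div_eq_mul_inv β,
    Real.rpow_mul hr0.le, Real.rpow_natCast]

/-- Oscillation bound for a scalar function, with an explicit constant. -/
theorem abs_sub_rpow_le_of_energy_le {B : Type*} [NormedAddCommGroup B] {f : ℝ → B}
    {g : ℝ → ℝ} (hg : Continuous g)
    (hfg : ∀ x ∈ Icc (0 : ℝ) 1, ∀ y ∈ Icc (0 : ℝ) 1, |g x - g y| ≤ ‖f x - f y‖)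
    {p β G s t : ℝ} (hp : 1 ≤ p) (hβ : 0 < β) (hG : 0 ≤ G)
    (h_energy : ∫⁻ q in Icc (0 : ℝ) 1 ×ˢ Icc (0 : ℝ) 1,
      ENNReal.ofReal (‖f q.1 - f q.2‖ ^ p / |q.1 - q.2| ^ (β + 2)) ≤ ENNReal.ofReal G)
    (hs : 0 ≤ s) (hst : s < t) (ht : t ≤ 1) :
    |g t - g s| ^ p ≤ (2 * Real.exp 1 * ((1 + β) / β)) ^ p * ((t - s) ^ β * G) := by
  have hp0 : 0 < p := by linarith
  have hd : 0 < t - s := by linarith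
  have hβ1 : 0 < 1 + β := by linarith
  set r : ℝ := (1 + β) ^ (-(p / β)) with hr
  have hr0 : 0 < r := by positivity
  have hr1 : r < 1 := Real.rpow_lt_one_of_one_lt_of_neg (by linarith) (by simp; positivity)
  have hru : r ^ (β / p) = (1 + β)⁻¹ := by
    rw [hr, ← Real.rpow_mul hβ1.le, show -(p / β) * (β / p) = -1 by field_simp,
      Real.rpow_neg_one]
  have hrinv : r⁻¹ ≤ Real.exp 1 ^ p := by
    rw [hr, Real.rpow_neg hβ1.le, inv_inv, Real.exp_one_rpow]
    calc (1 + β) ^ (p / β) ≤ Real.exp β ^ (p / β) := by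
          gcongr
          linarith [Real.add_one_le_exp β]
      _ = Real.exp p := by rw [← Real.exp_mul]; congr 1; field_simp
  have hS := abs_integral_cond_Icc_sub_le hg hfg hp hβ hG h_energy hs hst ht
    (left_mem_Icc.2 hst.le) hr0 hr1
  have hT := abs_integral_cond_Icc_sub_le hg hfg hp hβ hG h_energy hs hst ht
    (right_mem_Icc.2 hst.le) hr0 hr1
  rw [hru, show 1 - (1 + β)⁻¹ = β / (1 + β) by field_simp; ring] at hS hT
  have hC : ((t - s) ^ β * r⁻¹ * G) ^ p⁻¹ ≤ Real.exp 1 * ((t - s) ^ β * G) ^ p⁻¹ := by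
    calc ((t - s) ^ β * r⁻¹ * G) ^ p⁻¹ ≤ (Real.exp 1 ^ p * ((t - s) ^ β * G)) ^ p⁻¹ := by
          rw [mul_comm _ r⁻¹, mul_assoc]
          gcongr
      _ = _ := by
        rw [Real.mul_rpow (by positivity) (by positivity), Real.rpow_rpow_inv
          (Real.exp_pos 1).le hp0.ne']
  have htri : |g t - g s| ≤
      2 * Real.exp 1 * ((1 + β) / β) * ((t - s) ^ β * G) ^ p⁻¹ := by
    have h1 : ((t - s) ^ β * r⁻¹ * G) ^ p⁻¹ / (β / (1 + β)) ≤
        Real.exp 1 * ((t - s) ^ β * G) ^ p⁻¹ / (β / (1 + β)) := by gcongr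
    have h2 : 2 * Real.exp 1 * ((1 + β) / β) * ((t - s) ^ β * G) ^ p⁻¹ =
        2 * (Real.exp 1 * ((t - s) ^ β * G) ^ p⁻¹ / (β / (1 + β))) := by field_simp
    rw [h2]
    rw [abs_sub_le_iff] at hS hT
    rw [abs_sub_le_iff]
    exact ⟨by linarith, by linarith⟩
  calc |g t - g s| ^ p
      ≤ (2 * Real.exp 1 * ((1 + β) / β) * ((t - s) ^ β * G) ^ p⁻¹) ^ p := by gcongr
    _ = _ := by
      rw [Real.mul_rpow (by positivity) (by positivity), Real.rpow_inv_rpow (by positivity)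
        hp0.ne']

theorem two_mul_exp_one_mul_le {p γ : ℝ} (hp : 1 ≤ p) (hγ : 1 / p < γ) :
    2 * Real.exp 1 * ((1 + (γ * p - 1)) / (γ * p - 1)) ≤
      8 * 4 ^ (1 / p) * ((γ + 1 / p) / (γ - 1 / p)) := by
  have hp0 : 0 < p := by linarith
  have hβ : 0 < γ * p - 1 := by rw [div_lt_iff₀ hp0] at hγ; linarith
  have hratio : (γ + 1 / p) / (γ - 1 / p) = (γ * p + 1) / (γ * p - 1) := by
    have : γ - 1 / p ≠ 0 := by linarith
    field_simp
  have h4 : (1 : ℝ) ≤ 4 ^ (1 / p) := Real.one_le_rpow (by norm_num) (by positivity)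
  rw [hratio]
  refine mul_le_mul (by linarith [Real.exp_one_lt_d9]) ?_ (by positivity) (by positivity)
  exact div_le_div_of_nonneg_right (by linarith) hβ.le

/-- GRR-type supremum bound on `[0,1]`. -/
theorem grr_sup_bound
    {B : Type*} [NormedAddCommGroup B] [NormedSpace ℝ B]
    (f : ℝ → B) (hf : ContinuousOn f (Icc 0 1))
    (p γ' : ℝ) (hp : 1 ≤ p) (hγ' : 1 / p < γ') :
    (⨆ (s : ℝ) (t : ℝ) (_ : 0 ≤ s) (_ : s < t) (_ : t ≤ 1),
        ENNReal.ofReal (‖f t - f s‖ ^ p / (t - s) ^ (γ' * p - 1))) ≤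
      ENNReal.ofReal ((8 * 4 ^ (1 / p) * ((γ' + 1 / p) / (γ' - 1 / p))) ^ p) *
        ∫⁻ q in Icc (0:ℝ) 1 ×ˢ Icc (0:ℝ) 1,
          ENNReal.ofReal (‖f q.1 - f q.2‖ ^ p / |q.1 - q.2| ^ (γ' * p + 1)) := by
  have hp0 : 0 < p := by linarith
  have hβ : 0 < γ' * p - 1 := by rw [div_lt_iff₀ hp0] at hγ'; linarith
  have hK := two_mul_exp_one_mul_le hp hγ'
  have hK0 : 0 < 2 * Real.exp 1 * ((1 + (γ' * p - 1)) / (γ' * p - 1)) := by positivity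
  set K : ℝ := 8 * 4 ^ (1 / p) * ((γ' + 1 / p) / (γ' - 1 / p))
  have hKpos : 0 < K := hK0.trans_le hK
  set E := ∫⁻ q in Icc (0:ℝ) 1 ×ˢ Icc (0:ℝ) 1,
    ENNReal.ofReal (‖f q.1 - f q.2‖ ^ p / |q.1 - q.2| ^ (γ' * p + 1)) with hE
  rcases eq_or_ne E ⊤ with htop | htop
  · rw [htop, ENNReal.mul_top (by simpa using Real.rpow_pos_of_pos hKpos p)]
    exact le_top
  refine iSup_le fun s ↦ iSup_le fun t ↦ iSup_le fun hs ↦ iSup_le fun hst ↦ iSup_le fun ht ↦ ?_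
  have hd : 0 < t - s := by linarith
  set g : ℝ → ℝ := IccExtend zero_le_one fun x : Icc (0 : ℝ) 1 ↦ ‖f x - f s‖
  have hg : Continuous g :=
    (((continuousOn_iff_continuous_domRestrict.1 hf).sub continuous_const).norm).Icc_extend'
  have hgx : ∀ x ∈ Icc (0 : ℝ) 1, g x = ‖f x - f s‖ := fun x hx ↦ IccExtend_of_mem _ _ hx
  have hfg : ∀ x ∈ Icc (0 : ℝ) 1, ∀ y ∈ Icc (0 : ℝ) 1, |g x - g y| ≤ ‖f x - f y‖ := by
    intro x hx y hy
    rw [hgx x hx, hgx y hy]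
    simpa using abs_norm_sub_norm_le (f x - f s) (f y - f s)
  have h := abs_sub_rpow_le_of_energy_le hg hfg hp hβ ENNReal.toReal_nonneg (G := E.toReal)
    (by rw [ENNReal.ofReal_toReal htop, hE, show γ' * p - 1 + 2 = γ' * p + 1 by ring])
    hs hst ht
  rw [hgx t ⟨by linarith, ht⟩, hgx s ⟨hs, by linarith⟩, sub_self, norm_zero, sub_zero,
    abs_norm] at h
  rw [← ENNReal.ofReal_toReal htop, ← ENNReal.ofReal_mul (by positivity)]
  refine ENNReal.ofReal_le_ofReal ?_
  rw [div_le_iff₀ (by positivity)]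
  calc ‖f t - f s‖ ^ p
      ≤ K ^ p * ((t - s) ^ (γ' * p - 1) * E.toReal) := h.trans (by gcongr)
    _ = _ := by ring
end

section
/- Let (Ω, 𝔽, P) be a probability space, (B, ‖·‖) a separable Banach space, T > 0, n ≥ 1 an integer, λ ∈ (0,1), p₀ ≥ 2 and A > 0. Let X : Ω × [0,T] → B be a stochastic process with continuous sample paths such that E[‖X_t − X_s‖^p] ≤ A^p (p − 1)^{np/2} |t − s|^{λp/2} for every real p ≥ p₀ and all 0 ≤ s < t ≤ T. Then for every γ ∈ (0, λ/2) there exist constants m > 0 and ℓ > 0, depending only on λ, γ, n and p₀ (in particular independent of T, A and h), such that for all h > 0: P( [X]_{γ,[0,T]} > h ) ≤ m · exp( −ℓ · (h / (A · T^{λ/2 − γ}))^{2/n} ). -/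
open MeasureTheory Set Filter Topology

/-- If the increments of a continuous `f` over the dyadic intervals of level `k` are at most
`K * 2 ^ (-γ k)`, then `f` is `γ`-Hölder on the unit interval. -/
theorem norm_sub_le_of_dyadic_increments {B : Type*} [NormedAddCommGroup B]
    {f : ℝ → B} (hf : ContinuousOn f (Icc 0 1)) {K γ : ℝ} (hK : 0 ≤ K) (hγ : 0 < γ)
    (H : ∀ k j : ℕ, j < 2 ^ k →
      ‖f (((j : ℝ) + 1) / 2 ^ k) - f ((j : ℝ) / 2 ^ k)‖ ≤ K * ((1 / 2 : ℝ) ^ γ) ^ k)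
    {x y : ℝ} (hx : 0 ≤ x) (hxy : x < y) (hy : y ≤ 1) :
    ‖f y - f x‖ ≤ K * ((1 + 2 / (1 - (1 / 2 : ℝ) ^ γ)) / (1 / 2 : ℝ) ^ γ) * (y - x) ^ γ := by
  set r : ℝ := (1 / 2 : ℝ) ^ γ with hr
  have hr0 : 0 < r := by positivity
  have hr1 : r < 1 := Real.rpow_lt_one (by norm_num) (by norm_num) hγ
  have hstep : ∀ k a b : ℕ, a ≤ b → b ≤ a + 1 → b ≤ 2 ^ k →
      ‖f ((b : ℝ) / 2 ^ k) - f ((a : ℝ) / 2 ^ k)‖ ≤ K * r ^ k := by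
    intro k a b hab hba hb
    obtain rfl | rfl : b = a ∨ b = a + 1 := by omega
    · simp only [sub_self, norm_zero]
      positivity
    · have := H k a (by omega)
      push_cast
      exact this
  have hfloor : ∀ z : ℝ, z ≤ 1 → ∀ k : ℕ, ⌊z * 2 ^ k⌋₊ ≤ 2 ^ k := by
    intro z hz k
    refine Nat.floor_le_of_le ?_
    push_cast
    exact mul_le_of_le_one_left (by positivity) hz
  have happrox : ∀ z : ℝ, 0 ≤ z → z ≤ 1 → ∀ k : ℕ,
      ‖f ((⌊z * 2 ^ k⌋₊ : ℝ) / 2 ^ k) - f z‖ ≤ K * r ^ k / (1 - r) := by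
    intro z hz0 hz1 k
    have hlim : Tendsto (fun k : ℕ => (⌊z * 2 ^ k⌋₊ : ℝ) / 2 ^ k) atTop (𝓝 z) :=
      (tendsto_nat_floor_mul_div_atTop hz0).comp
        (tendsto_pow_atTop_atTop_of_one_lt (one_lt_two : (1 : ℝ) < 2))
    have hmem : ∀ k : ℕ, (⌊z * 2 ^ k⌋₊ : ℝ) / 2 ^ k ∈ Icc (0 : ℝ) 1 := by
      intro k
      refine ⟨by positivity, div_le_one_of_le₀ ?_ (by positivity)⟩
      exact_mod_cast hfloor z hz1 k
    have hflim : Tendsto (fun k : ℕ => f ((⌊z * 2 ^ k⌋₊ : ℝ) / 2 ^ k)) atTop (𝓝 (f z)) :=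
      (hf z ⟨hz0, hz1⟩).tendsto.comp
        (tendsto_nhdsWithin_iff.2 ⟨hlim, Eventually.of_forall hmem⟩)
    rw [← dist_eq_norm]
    refine dist_le_of_le_geometric_of_tendsto r K hr1 (fun i => ?_) hflim k
    have hnn : 0 ≤ z * 2 ^ i := by positivity
    have h2 : z * 2 ^ (i + 1) = 2 * (z * 2 ^ i) := by ring
    have hlo := Nat.floor_le hnn
    have hhi := Nat.lt_floor_add_one (z * 2 ^ i)
    have hge : 2 * ⌊z * 2 ^ i⌋₊ ≤ ⌊z * 2 ^ (i + 1)⌋₊ := by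
      refine Nat.le_floor ?_
      push_cast
      linarith
    have hlt : ⌊z * 2 ^ (i + 1)⌋₊ < 2 * ⌊z * 2 ^ i⌋₊ + 2 := by
      refine (Nat.floor_lt (by positivity)).2 ?_
      push_cast
      linarith
    have h := hstep (i + 1) (2 * ⌊z * 2 ^ i⌋₊) ⌊z * 2 ^ (i + 1)⌋₊ hge (by omega)
      (hfloor z hz1 (i + 1))
    have heq : ((2 * ⌊z * 2 ^ i⌋₊ : ℕ) : ℝ) / 2 ^ (i + 1) = (⌊z * 2 ^ i⌋₊ : ℝ) / 2 ^ i := by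
      push_cast
      rw [pow_succ]
      field_simp
    rw [heq] at h
    rw [dist_comm, dist_eq_norm]
    refine h.trans (mul_le_mul_of_nonneg_left ?_ hK)
    exact pow_le_pow_of_le_one hr0.le hr1.le (Nat.le_succ i)
  obtain ⟨k, hk1, hk2⟩ := exists_nat_pow_near_of_lt_one (x := y - x) (y := (1 / 2 : ℝ))
    (by linarith) (by linarith) (by norm_num) (by norm_num)
  have hk3 : y * 2 ^ k ≤ x * 2 ^ k + 1 := by
    have : (y - x) * 2 ^ k ≤ (1 / 2) ^ k * 2 ^ k := by gcongr
    rw [← mul_pow] at this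
    norm_num at this
    linarith
  have hmid := hstep k ⌊x * 2 ^ k⌋₊ ⌊y * 2 ^ k⌋₊ (by gcongr)
    (by
      rw [← Nat.floor_add_one (by positivity)]
      exact Nat.floor_le_floor hk3) (hfloor y hy k)
  have hax := happrox x hx (by linarith) k
  have hay := happrox y (by linarith) hy k
  have hrk : r ^ k * r ≤ (y - x) ^ γ := by
    rw [← pow_succ, hr, Real.rpow_pow_comm (by norm_num)]
    exact Real.rpow_le_rpow (by positivity) hk1.le hγ.le
  have htri : ‖f y - f x‖ ≤ K * r ^ k / (1 - r) + K * r ^ k + K * r ^ k / (1 - r) := by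
    rw [norm_sub_rev] at hay
    calc ‖f y - f x‖ = ‖(f y - f ((⌊y * 2 ^ k⌋₊ : ℝ) / 2 ^ k))
          + (f ((⌊y * 2 ^ k⌋₊ : ℝ) / 2 ^ k) - f ((⌊x * 2 ^ k⌋₊ : ℝ) / 2 ^ k))
          + (f ((⌊x * 2 ^ k⌋₊ : ℝ) / 2 ^ k) - f x)‖ := by congr 1; abel
      _ ≤ _ := norm_add₃_le.trans (by gcongr)
  have h1r : 0 < 1 - r := by linarith
  calc ‖f y - f x‖ ≤ K * ((1 + 2 / (1 - r)) / r) * (r ^ k * r) := by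
        refine htri.trans_eq ?_
        field_simp
        ring
    _ ≤ _ := by gcongr

/-- Chaining bound for the Hölder seminorm obtained from a single moment of the increments. -/
theorem measure_holder_seminorm_gt_le {B Ω : Type*} [NormedAddCommGroup B]
    [MeasurableSpace B] [BorelSpace B] [SecondCountableTopology B]
    [MeasurableSpace Ω] (P : Measure Ω) {T γ β p M C h : ℝ} (hT : 0 < T) (hγ : 0 < γ)
    (hp : 0 < p) (hβ : 2 ≤ (β - γ) * p) (hM : 0 ≤ M) (hh : 0 < h)
    (hC : C = (1 + 2 / (1 - (1 / 2 : ℝ) ^ γ)) / (1 / 2 : ℝ) ^ γ)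
    {X : Ω → ℝ → B} (hX : ∀ ω, ContinuousOn (X ω) (Icc 0 T))
    (hXm : ∀ t : ℝ, Measurable fun ω => X ω t)
    (hmom : ∀ s t : ℝ, 0 ≤ s → s < t → t ≤ T →
      ∫⁻ ω, ENNReal.ofReal (‖X ω t - X ω s‖ ^ p) ∂P ≤
        ENNReal.ofReal ((M * (t - s) ^ β) ^ p)) :
    P {ω | ENNReal.ofReal h <
        ⨆ (s : ℝ) (t : ℝ) (_ : 0 ≤ s) (_ : s < t) (_ : t ≤ T),
          ENNReal.ofReal (‖X ω t - X ω s‖ / (t - s) ^ γ)} ≤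
      ENNReal.ofReal (2 * (C * M * T ^ (β - γ) / h) ^ p) := by
  have hr0 : 0 < (1 / 2 : ℝ) ^ γ := by positivity
  have hr1 : (1 / 2 : ℝ) ^ γ < 1 := Real.rpow_lt_one (by norm_num) (by norm_num) hγ
  have hC0 : 0 < C := by
    have : 0 < 1 - (1 / 2 : ℝ) ^ γ := by linarith
    rw [hC]
    positivity
  set K : ℝ := h * T ^ γ / C with hKdef
  have hK : 0 < K := by positivity
  set S : ℕ → ℕ → Set Ω := fun k j =>
    {ω | K * ((1 / 2 : ℝ) ^ γ) ^ k <
      ‖X ω (T * (((j : ℝ) + 1) / 2 ^ k)) - X ω (T * ((j : ℝ) / 2 ^ k))‖} with hS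
  have hsub : {ω | ENNReal.ofReal h <
        ⨆ (s : ℝ) (t : ℝ) (_ : 0 ≤ s) (_ : s < t) (_ : t ≤ T),
          ENNReal.ofReal (‖X ω t - X ω s‖ / (t - s) ^ γ)} ⊆
      ⋃ k, ⋃ j ∈ Finset.range (2 ^ k), S k j := by
    intro ω hω
    simp only [mem_ofPred_eq, lt_iSup_iff] at hω
    obtain ⟨s, t, hs, hst, htT, hlt⟩ := hω
    by_contra hnot
    simp only [hS, mem_iUnion, Finset.mem_range, mem_ofPred_eq, not_exists, not_lt] at hnot
    have hcont : ContinuousOn (fun x => X ω (T * x)) (Icc 0 1) := by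
      refine (hX ω).comp (by fun_prop) ?_
      rintro x ⟨hx0, hx1⟩
      exact ⟨by positivity, mul_le_of_le_one_right hT.le hx1⟩
    have hle := norm_sub_le_of_dyadic_increments hcont hK.le hγ hnot
      (x := s / T) (y := t / T) (by positivity) (by gcongr) (div_le_one_of_le₀ htT hT.le)
    rw [← hC] at hle
    simp only [mul_div_cancel₀ _ hT.ne'] at hle
    have hts : 0 < t - s := by linarith
    rw [← sub_div, Real.div_rpow hts.le hT.le, hKdef] at hle
    have h1 : h * T ^ γ / C * C * ((t - s) ^ γ / T ^ γ) = h * (t - s) ^ γ := by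
      have : T ^ γ ≠ 0 := by positivity
      field_simp
    rw [h1] at hle
    have h2 := (ENNReal.ofReal_lt_ofReal_iff_of_nonneg hh.le).1 hlt
    rw [lt_div_iff₀ (by positivity)] at h2
    linarith
  set D : ℝ := (C * M * T ^ (β - γ) / h) ^ p with hD
  have hD0 : 0 ≤ D := by positivity
  have hone : ∀ k j : ℕ, j < 2 ^ k → P (S k j) ≤ ENNReal.ofReal (D * (1 / 4) ^ k) := by
    intro k j hj
    have hj' : (j : ℝ) + 1 ≤ 2 ^ k := by exact_mod_cast hj
    have hmo := hmom (T * ((j : ℝ) / 2 ^ k)) (T * (((j : ℝ) + 1) / 2 ^ k)) (by positivity)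
      (by gcongr; linarith)
      (mul_le_of_le_one_right hT.le (div_le_one_of_le₀ hj' (by positivity)))
    have hlen : T * (((j : ℝ) + 1) / 2 ^ k) - T * ((j : ℝ) / 2 ^ k) = T * (1 / 2) ^ k := by
      rw [div_pow, one_pow]; ring
    rw [hlen] at hmo
    have hKr : 0 < (K * ((1 / 2 : ℝ) ^ γ) ^ k) ^ p := by positivity
    have hmarkov : P (S k j) ≤ (∫⁻ ω, ENNReal.ofReal (‖X ω (T * (((j : ℝ) + 1) / 2 ^ k))
        - X ω (T * ((j : ℝ) / 2 ^ k))‖ ^ p) ∂P)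
          / ENNReal.ofReal ((K * ((1 / 2 : ℝ) ^ γ) ^ k) ^ p) := by
      refine (measure_mono ?_).trans (meas_ge_le_lintegral_div ?_ ?_ ENNReal.ofReal_ne_top)
      · intro ω hω
        exact ENNReal.ofReal_le_ofReal (Real.rpow_le_rpow (by positivity) (le_of_lt hω) hp.le)
      · exact ((((hXm _).sub (hXm _)).norm.pow_const p).ennreal_ofReal).aemeasurable
      · exact (ENNReal.ofReal_pos.2 hKr).ne'
    refine hmarkov.trans ((ENNReal.div_le_div_right hmo _).trans ?_)
    rw [← ENNReal.ofReal_div_of_pos hKr]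
    refine ENNReal.ofReal_le_ofReal ?_
    rw [← Real.div_rpow (by positivity) (by positivity)]
    have hq : M * (T * (1 / 2) ^ k) ^ β / (K * ((1 / 2 : ℝ) ^ γ) ^ k) =
        C * M * T ^ (β - γ) / h * ((1 / 2 : ℝ) ^ (β - γ)) ^ k := by
      rw [Real.mul_rpow hT.le (by positivity), Real.rpow_sub hT, Real.rpow_sub (by norm_num),
        ← Real.rpow_pow_comm (by norm_num) β, hKdef, div_pow ((1 / 2 : ℝ) ^ β)]
      generalize (1 / 2 : ℝ) ^ γ = r at hr0
      have hTγ : T ^ γ ≠ 0 := by positivity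
      field_simp
    rw [hq, Real.mul_rpow (by positivity) (by positivity), ← hD]
    refine mul_le_mul_of_nonneg_left ?_ hD0
    rw [← Real.rpow_pow_comm (by positivity), ← Real.rpow_mul (by norm_num)]
    refine pow_le_pow_left₀ (by positivity) ?_ k
    refine (Real.rpow_le_rpow_of_exponent_ge (by norm_num) (by norm_num) hβ).trans_eq ?_
    norm_num
  have hlevel : ∀ k : ℕ, P (⋃ j ∈ Finset.range (2 ^ k), S k j) ≤
      ENNReal.ofReal (D * (1 / 2) ^ k) := by
    intro k
    refine (measure_biUnion_finset_le _ _).trans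
      ((Finset.sum_le_sum fun j hj => hone k j (Finset.mem_range.1 hj)).trans_eq ?_)
    rw [Finset.sum_const, Finset.card_range, ← ENNReal.ofReal_nsmul, nsmul_eq_mul]
    congr 1
    push_cast
    rw [mul_left_comm, ← mul_pow]
    norm_num
  refine (measure_mono hsub).trans ((measure_iUnion_le _).trans
    ((ENNReal.tsum_le_tsum hlevel).trans_eq ?_))
  rw [← ENNReal.ofReal_tsum_of_nonneg (fun k => by positivity)
    (summable_geometric_two.mul_left D), tsum_mul_left, tsum_geometric_two, mul_comm]



/-- Concentration of the Hölder seminorm of a process with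
Wiener-chaos-type moment growth (abstract form of Proposition `ch`). -/
theorem holder_seminorm_concentration
    (n : ℕ) (hn : 1 ≤ n) (lam : ℝ) (hlam : lam ∈ Ioo (0:ℝ) 1)
    (γ : ℝ) (hγ : γ ∈ Ioo (0:ℝ) (lam / 2)) (p₀ : ℝ) (hp₀ : 2 ≤ p₀) :
    ∃ m ℓ : ℝ, 0 < m ∧ 0 < ℓ ∧
      ∀ (B : Type) [NormedAddCommGroup B] [NormedSpace ℝ B] [CompleteSpace B]
        [MeasurableSpace B] [BorelSpace B] [SecondCountableTopology B]
        (Ω : Type) [MeasurableSpace Ω] (P : Measure Ω) [IsProbabilityMeasure P]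
        (T A : ℝ), 0 < T → 0 < A →
        ∀ X : Ω → ℝ → B,
          (∀ ω, ContinuousOn (X ω) (Icc 0 T)) →
          (∀ t : ℝ, Measurable fun ω => X ω t) →
          (∀ p : ℝ, p₀ ≤ p → ∀ s t : ℝ, 0 ≤ s → s < t → t ≤ T →
            ∫⁻ ω, ENNReal.ofReal (‖X ω t - X ω s‖ ^ p) ∂P ≤
              ENNReal.ofReal
                (A ^ p * (p - 1) ^ ((n : ℝ) * p / 2) * (t - s) ^ (lam * p / 2))) →
          ∀ h : ℝ, 0 < h →
            P {ω | ENNReal.ofReal h <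
                ⨆ (s : ℝ) (t : ℝ) (_ : 0 ≤ s) (_ : s < t) (_ : t ≤ T),
                  ENNReal.ofReal (‖X ω t - X ω s‖ / (t - s) ^ γ)} ≤
              ENNReal.ofReal
                (m * Real.exp (-ℓ * (h / (A * T ^ (lam / 2 - γ))) ^ (2 / (n : ℝ)))) := by
  have hn0 : (0 : ℝ) < n := by exact_mod_cast hn
  obtain ⟨hγ0, hγl⟩ := hγ
  have hδ : 0 < lam / 2 - γ := by linarith
  obtain ⟨C, hC⟩ : ∃ C : ℝ, C = (1 + 2 / (1 - (1 / 2 : ℝ) ^ γ)) / (1 / 2 : ℝ) ^ γ := ⟨_, rfl⟩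
  have hC0 : 0 < C := by
    have : 0 < 1 - (1 / 2 : ℝ) ^ γ :=
      sub_pos.2 (Real.rpow_lt_one (by norm_num) (by norm_num) hγ0)
    rw [hC]
    positivity
  obtain ⟨p₁, hp₁⟩ : ∃ p₁ : ℝ, p₁ = max p₀ (2 / (lam / 2 - γ)) := ⟨_, rfl⟩
  have hp₁0 : 0 < p₁ := by rw [hp₁]; exact lt_max_of_lt_left (by linarith)
  refine ⟨2 * Real.exp p₁, (1 / (Real.exp 1 * C)) ^ (2 / (n : ℝ)), by positivity,
    by positivity, ?_⟩
  intro B _ _ _ _ _ _ Ω _ P _ T A hT hA X hX hXm hmom h hh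
  obtain ⟨u, hu⟩ : ∃ u : ℝ, u = h / (A * T ^ (lam / 2 - γ)) := ⟨_, rfl⟩
  have hu0 : 0 < u := by rw [hu]; positivity
  rw [← hu, neg_mul, ← Real.mul_rpow (by positivity) hu0.le]
  obtain ⟨p, hp⟩ : ∃ p : ℝ, p = (1 / (Real.exp 1 * C) * u) ^ (2 / (n : ℝ)) := ⟨_, rfl⟩
  rw [← hp]
  rcases lt_or_ge p p₁ with hlt | hge
  · refine prob_le_one.trans ?_
    rw [← ENNReal.ofReal_one]
    refine ENNReal.ofReal_le_ofReal ?_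
    rw [mul_assoc, ← Real.exp_add]
    have : 1 ≤ Real.exp (p₁ + -p) := Real.one_le_exp (by linarith)
    linarith
  have hp0 : 0 < p := hp₁0.trans_le hge
  have hpp₀ : p₀ ≤ p := (le_max_left _ _).trans (hp₁ ▸ hge)
  have hδp : 2 ≤ (lam / 2 - γ) * p := by
    have h2 : 2 / (lam / 2 - γ) ≤ p := (le_max_right _ _).trans (hp₁ ▸ hge)
    rwa [div_le_iff₀ hδ, mul_comm] at h2
  have hroot : p ^ ((n : ℝ) / 2) = 1 / (Real.exp 1 * C) * u := by
    rw [hp, ← Real.rpow_mul (by positivity), show 2 / (n : ℝ) * (n / 2) = 1 by field_simp,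
      Real.rpow_one]
  have hbound := measure_holder_seminorm_gt_le P (β := lam / 2) (M := A * p ^ ((n : ℝ) / 2))
    hT hγ0 hp0 hδp (by positivity) hh hC hX hXm (by
      intro s t hs hst ht
      refine (hmom p hpp₀ s t hs hst ht).trans (ENNReal.ofReal_le_ofReal ?_)
      have hts : 0 < t - s := by linarith
      rw [Real.mul_rpow (by positivity) (by positivity), Real.mul_rpow hA.le (by positivity),
        ← Real.rpow_mul hp0.le, ← Real.rpow_mul hts.le, div_mul_eq_mul_div, div_mul_eq_mul_div]
      have : (p - 1) ^ ((n : ℝ) * p / 2) ≤ p ^ ((n : ℝ) * p / 2) :=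
        Real.rpow_le_rpow (by linarith) (by linarith) (by positivity)
      gcongr)
  refine hbound.trans (ENNReal.ofReal_le_ofReal ?_)
  have hratio : C * (A * p ^ ((n : ℝ) / 2)) * T ^ (lam / 2 - γ) / h = Real.exp (-1) := by
    rw [hroot, hu, Real.exp_neg]
    have : T ^ (lam / 2 - γ) ≠ 0 := by positivity
    field_simp
  rw [hratio, ← Real.exp_mul, neg_one_mul]
  have : 1 ≤ Real.exp p₁ := Real.one_le_exp hp₁0.le
  gcongr
  linarith
end
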